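/- Suppose G belongs to the family F_n and Q belongs to Q_G with level ℓ. Then ℓ is odd (2 does not divide ℓ). -/

import Mathlib

open Matrix Polynomial

/-- Alternating forms vanish on the diagonal. -/
theorem dotProduct_mulVec_self_zmod_two {ι : Type*} [Fintype ι] (A : Matrix ι ι (ZMod 2)) (hA : Aᵀ = A)
    (h0 : ∀ i, A i i = 0) (x : ι → ZMod 2) : x ⬝ᵥ A *ᵥ x = 0 := by
  simp only [dotProduct, mulVec, Finset.mul_sum]
  rw [← Finset.sum_product']
  refine Finset.sum_involution (fun a _ => (a.2, a.1)) ?_ ?_ ?_ ?_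
  · rintro ⟨i, j⟩ -
    have : A j i = A i j := congrFun (congrFun hA i) j
    simp only [this]
    have h2 := CharTwo.add_self_eq_zero (x i * (A i j * x j))
    linear_combination h2
  · rintro ⟨i, j⟩ - h hij
    obtain rfl : j = i := congrArg Prod.fst hij
    exact h (by simp [h0])
  · simp
  · simp

section Walk

variable {ι R : Type*} [Fintype ι] [DecidableEq ι] [CommRing R]

/-- The action of a polynomial in `A` on the all-one vector. -/
noncomputable def polyWalk (A : Matrix ι ι R) : R[X] →ₗ[R] (ι → R) where
  toFun p := aeval A p *ᵥ 1
  map_add' p q := by rw [map_add, add_mulVec]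
  map_smul' c p := by rw [map_smul, smul_mulVec, RingHom.id_apply]

theorem polyWalk_apply (A : Matrix ι ι R) (p : R[X]) : polyWalk A p = aeval A p *ᵥ 1 := rfl

theorem polyWalk_mul (A : Matrix ι ι R) (p q : R[X]) :
    polyWalk A (p * q) = aeval A p *ᵥ polyWalk A q := by
  simp [polyWalk_apply, mulVec_mulVec]

/-- The weighted total number of walks attached to a polynomial in `A`. -/
noncomputable def walkSum (A : Matrix ι ι R) : R[X] →ₗ[R] R :=
  dotProductBilin R R (1 : ι → R) ∘ₗ polyWalk A

theorem walkSum_apply (A : Matrix ι ι R) (p : R[X]) : walkSum A p = 1 ⬝ᵥ polyWalk A p := rfl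

theorem transpose_aeval (A : Matrix ι ι R) (hA : Aᵀ = A) (p : R[X]) :
    (aeval A p)ᵀ = aeval A p := by
  induction p using Polynomial.induction_on' with
  | add p q hp hq => simp [hp, hq]
  | monomial k a => simp [aeval_monomial, transpose_pow, hA, Algebra.algebraMap_eq_smul_one]

theorem polyWalk_dotProduct (A : Matrix ι ι R) (hA : Aᵀ = A) (p q : R[X]) :
    polyWalk A p ⬝ᵥ polyWalk A q = walkSum A (p * q) := by
  rw [walkSum_apply, polyWalk_mul, dotProduct_mulVec, ← mulVec_transpose, transpose_aeval A hA,
    polyWalk_apply A p]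

theorem walkSum_X_pow_succ_zmod_two (A : Matrix ι ι (ZMod 2)) (hA : Aᵀ = A)
    (h0 : ∀ i, A i i = 0) (k : ℕ) : walkSum A (X ^ (k + 1)) = 0 := by
  induction k using Nat.strong_induction_on with
  | _ k ih =>
    rcases Nat.even_or_odd' k with ⟨m, rfl | rfl⟩
    · have : (X : (ZMod 2)[X]) ^ (2 * m + 1) = X ^ m * (X * X ^ m) := by ring
      rw [this, ← polyWalk_dotProduct A hA, polyWalk_mul, aeval_X,
        dotProduct_mulVec_self_zmod_two A hA h0]
    · have : (X : (ZMod 2)[X]) ^ (2 * m + 1 + 1) = X ^ (m + 1) * X ^ (m + 1) := by ring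
      rw [this, ← polyWalk_dotProduct A hA, ← ih m (by omega), walkSum_apply]
      have hsq : ∀ c : ZMod 2, c * c = c := by decide
      simp [dotProduct, hsq]

theorem walkSum_X_mul_zmod_two (A : Matrix ι ι (ZMod 2)) (hA : Aᵀ = A)
    (h0 : ∀ i, A i i = 0) (p : (ZMod 2)[X]) : walkSum A (X * p) = 0 := by
  induction p using Polynomial.induction_on' with
  | add p q hp hq => rw [mul_add, map_add, hp, hq, add_zero]
  | monomial k a =>
    have : X * monomial k a = a • (X : (ZMod 2)[X]) ^ (k + 1) := by
      rw [← C_mul_X_pow_eq_monomial, smul_eq_C_mul]; ring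
    rw [this, map_smul, walkSum_X_pow_succ_zmod_two A hA h0, smul_zero]

/-- Twice the rank of the walk module modulo two is at most the number of vertices plus one. -/
theorem two_mul_finrank_range_polyWalk_le (A : Matrix ι ι (ZMod 2)) (hA : Aᵀ = A)
    (h0 : ∀ i, A i i = 0) :
    2 * Module.finrank (ZMod 2) (LinearMap.range (polyWalk A)) ≤ Fintype.card ι + 1 := by
  set U := LinearMap.range (polyWalk A) with hU
  set V := U.map A.mulVecLin with hV
  have h1 : Module.finrank (ZMod 2) U ≤ Module.finrank (ZMod 2) V + 1 := by
    have hle : U ≤ V ⊔ Submodule.span (ZMod 2) {1} := by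
      rintro _ ⟨p, rfl⟩
      rw [← X_mul_divX_add p, map_add]
      refine Submodule.add_mem_sup ?_ ?_
      · refine ⟨polyWalk A p.divX, ⟨_, rfl⟩, ?_⟩
        rw [polyWalk_mul, aeval_X, mulVecLin_apply]
      · rw [polyWalk_apply, aeval_C, Algebra.algebraMap_eq_smul_one, smul_mulVec, one_mulVec]
        exact Submodule.smul_mem _ _ (Submodule.mem_span_singleton_self _)
    calc _ ≤ _ := Submodule.finrank_mono hle
      _ ≤ _ := Submodule.finrank_add_le_finrank_add_finrank _ _
      _ ≤ _ := by gcongr; exact (finrank_span_le_card _).trans (by simp)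
  have h2 : Module.finrank (ZMod 2) V + Module.finrank (ZMod 2) U ≤ Fintype.card ι := by
    have hle : V.map (dotProductEquiv (ZMod 2) ι).toLinearMap ≤ U.dualAnnihilator := by
      rintro _ ⟨_, ⟨_, ⟨p, rfl⟩, rfl⟩, rfl⟩
      rw [Submodule.mem_dualAnnihilator]
      rintro _ ⟨q, rfl⟩
      have : A.mulVecLin (polyWalk A p) = polyWalk A (X * p) := by
        rw [polyWalk_mul, aeval_X, mulVecLin_apply]
      rw [this]
      change polyWalk A (X * p) ⬝ᵥ polyWalk A q = 0
      rw [polyWalk_dotProduct A hA, mul_assoc, walkSum_X_mul_zmod_two A hA h0]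
    have h3 := Submodule.finrank_mono hle
    rw [LinearEquiv.finrank_map_eq (dotProductEquiv (ZMod 2) ι)] at h3
    have h4 := Subspace.finrank_add_finrank_dualAnnihilator_eq U
    rw [Module.finrank_pi] at h4
    omega
  omega

end Walk

theorem dvd_of_X_mul_sq_eq {ψ p t : (ZMod 2)[X]} (h : X * p ^ 2 = ψ ^ 2 * t) : ψ ∣ p := by
  by_cases hψ : ψ = 0
  · subst hψ
    simp at h
    simp [h]
  have h1 : (X * p) ^ 2 = ψ ^ 2 * (X * t) := by linear_combination X * h
  obtain ⟨w, hw⟩ : ψ ∣ X * p := (UniqueFactorizationMonoid.pow_dvd_pow_iff_dvd two_ne_zero).1 ⟨_, h1⟩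
  rw [hw, mul_pow] at h1
  have h2 := mul_left_cancel₀ (pow_ne_zero 2 hψ) h1
  obtain ⟨v, rfl⟩ : X ∣ w := prime_X.dvd_of_dvd_pow ⟨t, h2⟩
  refine ⟨v, mul_left_cancel₀ X_ne_zero ?_⟩
  rw [hw]; ring

theorem natAbs_det_eq_index_range_mulVecLin {ι : Type*} [Fintype ι] [DecidableEq ι]
    (W : Matrix ι ι ℤ) (h : W.det ≠ 0) :
    (LinearMap.range W.mulVecLin).toAddSubgroup.index = W.det.natAbs := by
  rw [AddSubgroup.index]
  have h1 := Submodule.natAbs_det_equiv (LinearMap.range W.mulVecLin)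
    (LinearEquiv.ofInjective W.mulVecLin (mulVec_injective_of_det_ne_zero h))
  refine Eq.trans h1.symm ?_
  rw [← LinearMap.det_toLin' W]
  rfl

theorem polyWalk_map {ι R S : Type*} [Fintype ι] [DecidableEq ι] [CommRing R] [CommRing S]
    (f : R →+* S) (A : Matrix ι ι R) (p : R[X]) :
    polyWalk (A.map f) (p.map f) = f ∘ polyWalk A p := by
  induction p using Polynomial.induction_on' with
  | add p q hp hq =>
    rw [Polynomial.map_add, map_add, map_add, hp, hq]
    ext; simp
  | monomial k a =>
    ext i
    have h := RingHom.map_mulVec f (A ^ k) 1 i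
    have h1 : (⇑f ∘ 1 : ι → S) = 1 := by ext; simp
    rw [h1, ← RingHom.mapMatrix_apply, map_pow, RingHom.mapMatrix_apply] at h
    simp [polyWalk_apply, aeval_monomial, Algebra.algebraMap_eq_smul_one, smul_mulVec, h]

theorem walkSum_map {ι R S : Type*} [Fintype ι] [DecidableEq ι] [CommRing R] [CommRing S]
    (f : R →+* S) (A : Matrix ι ι R) (p : R[X]) :
    walkSum (A.map f) (p.map f) = f (walkSum A p) := by
  rw [walkSum_apply, walkSum_apply, polyWalk_map, RingHom.map_dotProduct]
  congr 1
  ext; simp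

section Integral

variable {ι : Type*} [Fintype ι] [DecidableEq ι]

theorem even_walkSum_X_mul (A : Matrix ι ι ℤ) (hA : Aᵀ = A) (h0 : ∀ i, A i i = 0) (p : ℤ[X]) :
    2 ∣ walkSum A (X * p) := by
  have h := walkSum_map (Int.castRingHom (ZMod 2)) A (X * p)
  rw [Polynomial.map_mul, map_X, walkSum_X_mul_zmod_two _ (by rw [← transpose_map, hA])
    (by simp [h0])] at h
  exact (ZMod.intCast_zmod_eq_zero_iff_dvd _ 2).1 h.symm

/-- A polynomial lies in the kernel of the walk map modulo two. -/
def WalkEven (A : Matrix ι ι ℤ) (p : ℤ[X]) : Prop := ∀ i, 2 ∣ polyWalk A p i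

theorem walkEven_iff (A : Matrix ι ι ℤ) (p : ℤ[X]) :
    WalkEven A p ↔ polyWalk (A.map (Int.castRingHom (ZMod 2)))
      (p.map (Int.castRingHom (ZMod 2))) = 0 := by
  rw [polyWalk_map, funext_iff]
  exact forall_congr' fun i => (ZMod.intCast_zmod_eq_zero_iff_dvd _ 2).symm

theorem map_castRingHom_zmod_two_eq_iff (p q : ℤ[X]) :
    p.map (Int.castRingHom (ZMod 2)) = q.map (Int.castRingHom (ZMod 2)) ↔
      ∃ r : ℤ[X], p = q + 2 * r := by
  constructor
  · intro h
    have : ∀ k, ∃ c : ℤ, (p - q).coeff k = 2 * c := fun k => by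
      have h1 := congrArg (fun r => r.coeff k) h
      simp only [coeff_map, eq_intCast] at h1
      rw [← sub_eq_zero, ← Int.cast_sub, ZMod.intCast_zmod_eq_zero_iff_dvd, ← coeff_sub] at h1
      exact h1
    have : C (2 : ℤ) ∣ p - q := C_dvd_iff_dvd_coeff _ _ |>.2 this
    obtain ⟨r, hr⟩ := this
    refine ⟨r, ?_⟩
    rw [← sub_eq_iff_eq_add', hr]; rfl
  · rintro ⟨r, rfl⟩
    have : (2 : (ZMod 2)[X]) = 0 := CharTwo.two_eq_zero
    simp [this]

/-- The kernel of the walk map modulo two is principal modulo two. -/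
theorem exists_walkEven_generator (A : Matrix ι ι ℤ) :
    ∃ ψ : ℤ[X], ∀ p, WalkEven A p ↔ ∃ q r, p = ψ * q + 2 * r := by
  let f := Int.castRingHom (ZMod 2)
  let I : Ideal (ZMod 2)[X] :=
    { carrier := {p | polyWalk (A.map f) p = 0}
      add_mem' := fun {p q} hp hq => by
        simp only [Set.mem_ofPred_eq] at *; rw [map_add, hp, hq, add_zero]
      zero_mem' := map_zero _
      smul_mem' := fun c p hp => by
        simp only [Set.mem_ofPred_eq, smul_eq_mul] at *
        rw [polyWalk_mul, hp, mulVec_zero] }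
  obtain ⟨ψ₀, hψ₀⟩ := IsPrincipalIdealRing.principal I
  have hf : Function.Surjective (Polynomial.map f) :=
    Polynomial.map_surjective f (ZMod.ringHom_surjective f)
  obtain ⟨ψ, rfl⟩ := hf ψ₀
  refine ⟨ψ, fun p => ?_⟩
  have h1 : WalkEven A p ↔ p.map f ∈ I := walkEven_iff A p
  rw [h1, hψ₀, Ideal.submodule_span_eq, Ideal.mem_span_singleton]
  constructor
  · rintro ⟨q₀, hq⟩
    obtain ⟨q, rfl⟩ := hf q₀
    rw [← Polynomial.map_mul] at hq
    exact ⟨q, (map_castRingHom_zmod_two_eq_iff _ _).1 hq⟩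
  · rintro ⟨q, hr⟩
    refine ⟨q.map f, ?_⟩
    rw [← Polynomial.map_mul]
    exact (map_castRingHom_zmod_two_eq_iff _ _).2 hr

/-- If, up to odd multiples, the walk lattice contains all even vectors, then the kernel of the
walk map modulo two is determined by the numbers of walks. -/
theorem walkEven_iff_forall_four_dvd (A : Matrix ι ι ℤ) (hA : Aᵀ = A) (h0 : ∀ i, A i i = 0)
    {d : ℕ} (hd : Odd d) (hW : ∀ y : ι → ℤ, ∃ p, (2 * (d : ℤ)) • y = polyWalk A p) (p : ℤ[X]) :
    WalkEven A p ↔ ∀ q, 4 ∣ walkSum A (p ^ 2 * q) := by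
  have two_mul_map : ∀ r, walkSum A (2 * r) = 2 * walkSum A r := fun r => by
    rw [two_mul, map_add, two_mul]
  constructor
  · intro h q
    choose x hx using h
    have hx' : polyWalk A p = (2 : ℤ) • x := funext hx
    have : p ^ 2 * q = p * (q * p) := by ring
    rw [this, ← polyWalk_dotProduct A hA, polyWalk_mul, hx', mulVec_smul, smul_dotProduct,
      dotProduct_smul, smul_smul]
    exact ⟨_, rfl⟩
  · have dual : ∀ u : ℤ[X], (∀ q, WalkEven A q → 4 ∣ walkSum A (u * q)) → WalkEven A u := by
      intro u hu i
      obtain ⟨q, hq⟩ := hW (Pi.single i 1)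
      have h1 := hu q fun j => by
        rw [← hq, Pi.smul_apply, smul_eq_mul, mul_assoc]
        exact ⟨_, rfl⟩
      rw [← polyWalk_dotProduct A hA, ← hq, dotProduct_smul, dotProduct_single_one,
        smul_eq_mul] at h1
      obtain ⟨c, hc⟩ := h1
      obtain ⟨m, rfl⟩ := hd
      refine ⟨c - m * polyWalk A u i, ?_⟩
      push_cast at hc
      linarith
    intro H
    obtain ⟨ψ, hψ⟩ := exists_walkEven_generator A
    obtain ⟨s, r, hs⟩ := (hψ _).1 (dual (p ^ 2) fun q _ => H q)
    have hXs : WalkEven A (X * s) := by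
      refine dual _ fun q hq => ?_
      obtain ⟨q', r', rfl⟩ := (hψ q).1 hq
      have : X * s * (ψ * q' + 2 * r') =
          p ^ 2 * (X * q') + (2 * (X * (s * r')) - 2 * (X * (r * q'))) := by
        rw [hs]; ring
      rw [this, map_add, map_sub, two_mul_map, two_mul_map]
      obtain ⟨a, ha⟩ := H (X * q')
      obtain ⟨b, hb⟩ := even_walkSum_X_mul A hA h0 (s * r')
      obtain ⟨c, hc⟩ := even_walkSum_X_mul A hA h0 (r * q')
      rw [ha, hb, hc]
      exact ⟨a + b - c, by ring⟩
    obtain ⟨t, w, ht⟩ := (hψ _).1 hXs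
    let f := Int.castRingHom (ZMod 2)
    have hdvd : ψ.map f ∣ p.map f := by
      refine dvd_of_X_mul_sq_eq (t := t.map f) ?_
      rw [← map_X f, ← Polynomial.map_pow, ← Polynomial.map_pow, ← Polynomial.map_mul,
        ← Polynomial.map_mul]
      refine (map_castRingHom_zmod_two_eq_iff _ _).2 ⟨ψ * w + X * r, ?_⟩
      linear_combination X * hs + ψ * ht
    obtain ⟨v₀, hv⟩ := hdvd
    obtain ⟨v, rfl⟩ := Polynomial.map_surjective f (ZMod.ringHom_surjective f) v₀
    rw [← Polynomial.map_mul] at hv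
    exact (hψ p).2 ⟨v, (map_castRingHom_zmod_two_eq_iff _ _).1 hv⟩

end Integral

section WalkMatrix

variable {n : ℕ}

/-- The walk matrix. -/
def walkMatrix (A : Matrix (Fin n) (Fin n) ℤ) : Matrix (Fin n) (Fin n) ℤ :=
  Matrix.of fun i j => (A ^ (j : ℕ) *ᵥ 1) i

theorem walkMatrix_mulVec (A : Matrix (Fin n) (Fin n) ℤ) (x : Fin n → ℤ) :
    walkMatrix A *ᵥ x = polyWalk A (∑ j, C (x j) * X ^ (j : ℕ)) := by
  ext i
  rw [map_sum, Finset.sum_apply]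
  simp only [mulVec, dotProduct, walkMatrix, of_apply, ← smul_eq_C_mul, map_smul, Pi.smul_apply,
    polyWalk_apply, map_pow, aeval_X, smul_eq_mul, mul_comm (x _)]

theorem transpose_walkMatrix_mul (A : Matrix (Fin n) (Fin n) ℤ) (hA : Aᵀ = A) (i j : Fin n) :
    ((walkMatrix A)ᵀ * walkMatrix A) i j = walkSum A (X ^ ((i : ℕ) + j)) := by
  rw [pow_add, ← polyWalk_dotProduct A hA]
  simp [mul_apply, dotProduct, walkMatrix, polyWalk_apply]

theorem natAbs_det_walkMatrix_eq (A B : Matrix (Fin n) (Fin n) ℤ) (hA : Aᵀ = A) (hB : Bᵀ = B)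
    (h : ∀ p, walkSum A p = walkSum B p) :
    (walkMatrix A).det.natAbs = (walkMatrix B).det.natAbs := by
  have h1 : (walkMatrix A)ᵀ * walkMatrix A = (walkMatrix B)ᵀ * walkMatrix B := by
    ext i j
    rw [transpose_walkMatrix_mul A hA, transpose_walkMatrix_mul B hB, h]
  have h2 := congrArg det h1
  rw [det_mul, det_mul, det_transpose, det_transpose] at h2
  exact Int.natAbs_eq_iff_mul_self_eq.2 h2

/-- If the walk matrix has the smallest possible power of two in its determinant, then the walk
lattice contains all even vectors, up to an odd multiple. -/
theorem exists_odd_two_mul_smul_eq_polyWalk (A : Matrix (Fin n) (Fin n) ℤ) (hA : Aᵀ = A)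
    (h0 : ∀ i, A i i = 0) {c : ℕ} (hc : Odd c)
    (hdet : (walkMatrix A).det.natAbs = 2 ^ (n / 2) * c) :
    ∃ d : ℕ, Odd d ∧ ∀ y : Fin n → ℤ, ∃ p, (2 * (d : ℤ)) • y = polyWalk A p := by
  let f := Int.castRingHom (ZMod 2)
  let U := LinearMap.range (polyWalk (A.map f))
  let red : (Fin n → ℤ) →+ (Fin n → ZMod 2) := f.toAddMonoidHom.compLeft (Fin n)
  have hred : Function.Surjective red := (ZMod.ringHom_surjective f).comp_left
  let L := (LinearMap.range (walkMatrix A).mulVecLin).toAddSubgroup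
  let M := U.toAddSubgroup.comap red
  have hLM : L ≤ M := by
    rintro _ ⟨x, rfl⟩
    rw [mulVecLin_apply, walkMatrix_mulVec]
    exact ⟨_, polyWalk_map f A _⟩
  have hdet0 : (walkMatrix A).det ≠ 0 := by
    rw [← Int.natAbs_ne_zero, hdet]
    exact mul_ne_zero (by positivity) hc.pos.ne'
  have hL : L.index = 2 ^ (n / 2) * c := by
    rw [← hdet]; exact natAbs_det_eq_index_range_mulVecLin _ hdet0
  have hM : 2 ^ (n / 2) ∣ M.index := by
    have h1 : M.index = U.toAddSubgroup.index := AddSubgroup.index_comap_of_surjective _ hred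
    have h2 := U.toAddSubgroup.card_mul_index
    have h3 : Nat.card U = 2 ^ Module.finrank (ZMod 2) U := by
      rw [Module.natCard_eq_pow_finrank (K := ZMod 2), Nat.card_zmod]
    have h4 : Nat.card U.toAddSubgroup = Nat.card U := rfl
    have h5 := two_mul_finrank_range_polyWalk_le (A.map f) (by rw [← transpose_map, hA])
      (by simp [h0])
    rw [Fintype.card_fin] at h5
    change 2 * Module.finrank (ZMod 2) U ≤ _ at h5
    rw [h4, h3, Nat.card_fun, Nat.card_zmod, Nat.card_fin] at h2
    rw [h1]
    refine ⟨2 ^ (n - n / 2 - Module.finrank (ZMod 2) U), ?_⟩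
    refine Nat.eq_of_mul_eq_mul_left (by positivity : 0 < 2 ^ Module.finrank (ZMod 2) U) ?_
    rw [h2, ← pow_add, ← pow_add]
    congr 1
    omega
  have hmul : L.relIndex M * M.index = L.index := AddSubgroup.relIndex_mul_index hLM
  refine ⟨L.relIndex M, ?_, fun y => ?_⟩
  · obtain ⟨m, hm⟩ := hM
    have : L.relIndex M * m = c := by
      refine Nat.eq_of_mul_eq_mul_left (by positivity : 0 < 2 ^ (n / 2)) ?_
      rw [← hL, ← hmul, hm]; ring
    exact Nat.Odd.of_mul_left (this ▸ hc)
  · have h2y : (2 : ℤ) • y ∈ M := by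
      change red ((2 : ℤ) • y) ∈ U
      have : red ((2 : ℤ) • y) = 0 := by
        rw [map_zsmul]
        ext i
        simp [CharTwo.two_eq_zero]
      rw [this]
      exact zero_mem _
    have h := (L.addSubgroupOf M).nsmul_index_mem ⟨_, h2y⟩
    rw [AddSubgroup.mem_addSubgroupOf] at h
    obtain ⟨x, hx⟩ := h
    refine ⟨_, Eq.trans ?_ (hx.symm.trans (walkMatrix_mulVec A x))⟩
    change _ = L.relIndex M • ((2 : ℤ) • y)
    rw [← natCast_zsmul, smul_smul, mul_comm]

end WalkMatrix

section Orthogonal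

variable {ι : Type*} [Fintype ι] [DecidableEq ι]

theorem polyWalk_eq_mulVec_of_semiconj {R : Type*} [CommRing R] (A B Q : Matrix ι ι R)
    (hQ : A * Q = Q * B) (hQe : Q *ᵥ 1 = 1) (p : R[X]) :
    polyWalk A p = Q *ᵥ polyWalk B p := by
  have hpow : ∀ k : ℕ, A ^ k * Q = Q * B ^ k := fun k =>
    ((show SemiconjBy Q B A from hQ.symm).pow_right k).symm
  have : aeval A p * Q = Q * aeval B p := by
    induction p using Polynomial.induction_on' with
    | add p q hp hq => rw [map_add, map_add, add_mul, mul_add, hp, hq]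
    | monomial k a => simp [aeval_monomial, Algebra.algebraMap_eq_smul_one, hpow]
  rw [polyWalk_apply, polyWalk_apply, mulVec_mulVec, ← this, ← mulVec_mulVec, hQe]

theorem walkSum_eq_of_semiconj {R : Type*} [CommRing R] (A B Q : Matrix ι ι R)
    (hQ : A * Q = Q * B) (hQe : Q *ᵥ 1 = 1) (hQo : Qᵀ * Q = 1) (p : R[X]) :
    walkSum A p = walkSum B p := by
  have h1 : Qᵀ *ᵥ 1 = 1 := by
    conv_lhs => rw [← hQe, mulVec_mulVec, hQo, one_mulVec]
  rw [walkSum_apply, walkSum_apply, polyWalk_eq_mulVec_of_semiconj A B Q hQ hQe,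
    dotProduct_mulVec, ← mulVec_transpose, h1]

end Orthogonal

/-- An orthogonal matrix that conjugates one graph with the smallest possible power of two in its
walk determinant to another becomes integral after multiplication by an odd number. -/
theorem exists_odd_mul_integral {n : ℕ} (A B : Matrix (Fin n) (Fin n) ℤ)
    (hA : Aᵀ = A) (hA0 : ∀ i, A i i = 0) (hB : Bᵀ = B) (hB0 : ∀ i, B i i = 0)
    {c : ℕ} (hc : Odd c) (hdet : (walkMatrix A).det.natAbs = 2 ^ (n / 2) * c)
    (Q : Matrix (Fin n) (Fin n) ℚ) (hQo : Qᵀ * Q = 1) (hQe : Q *ᵥ 1 = 1)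
    (hQ : A.map (Int.castRingHom ℚ) * Q = Q * B.map (Int.castRingHom ℚ)) :
    ∃ d : ℕ, Odd d ∧ ∀ i j, ∃ z : ℤ, (d : ℚ) * Q i j = z := by
  let f := Int.castRingHom ℚ
  have hsum : ∀ p, walkSum A p = walkSum B p := fun p => by
    have h := walkSum_eq_of_semiconj _ _ Q hQ hQe hQo (p.map f)
    rw [walkSum_map, walkSum_map] at h
    exact Int.cast_injective h
  obtain ⟨dA, hdA, hLA⟩ := exists_odd_two_mul_smul_eq_polyWalk A hA hA0 hc hdet
  obtain ⟨d, hd, hLB⟩ := exists_odd_two_mul_smul_eq_polyWalk B hB hB0 hc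
    (natAbs_det_walkMatrix_eq A B hA hB hsum ▸ hdet)
  refine ⟨d, hd, fun i j => ?_⟩
  obtain ⟨p, hp⟩ := hLB (Pi.single j 1)
  have hpB : WalkEven B p := fun k => by
    rw [← hp, Pi.smul_apply, smul_eq_mul, mul_assoc]
    exact ⟨_, rfl⟩
  have hpA : WalkEven A p := by
    rw [walkEven_iff_forall_four_dvd A hA hA0 hdA hLA]
    simp only [hsum]
    exact (walkEven_iff_forall_four_dvd B hB hB0 hd hLB p).1 hpB
  obtain ⟨z, hz⟩ := hpA i
  refine ⟨z, ?_⟩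
  have h := congrFun (polyWalk_eq_mulVec_of_semiconj _ _ Q hQ hQe (p.map f)) i
  rw [polyWalk_map, polyWalk_map, ← hp] at h
  have h1 : (⇑f ∘ ((2 * (d : ℤ)) • Pi.single j 1) : Fin n → ℚ) = (2 * (d : ℚ)) • Pi.single j 1 := by
    ext k
    by_cases hk : k = j
    · subst hk; simp [f]
    · simp [hk]
  rw [h1, mulVec_smul, mulVec_single_one, Function.comp_apply, hz, Pi.smul_apply, col_apply,
    smul_eq_mul] at h
  simp only [eq_intCast, Int.cast_mul, Int.cast_ofNat] at h
  linarith

/-- If `G ∈ F_n` and `Q ∈ Q_G` has level `ℓ`, then `ℓ` is odd. -/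
theorem stmt_15 (n : ℕ) (hn : 0 < n)
    (A : Matrix (Fin n) (Fin n) ℤ)
    (hA_symm : Aᵀ = A)
    (hA_diag : ∀ i, A i i = 0)
    (hA_01 : ∀ i j, A i j = 0 ∨ A i j = 1)
    (W : Matrix (Fin n) (Fin n) ℤ)
    (hW : W = Matrix.of fun (i j : Fin n) => (A ^ (j : ℕ)).mulVec (fun _ => (1 : ℤ)) i)
    (hF : ∃ ε b : ℤ, (ε = 1 ∨ ε = -1) ∧ Odd b ∧ Squarefree b ∧
      W.det = ε * 2 ^ (n / 2) * b)
    (Q : Matrix (Fin n) (Fin n) ℚ)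
    (hQ_orth : Qᵀ * Q = 1)
    (hQ_e : Q.mulVec (fun _ => (1 : ℚ)) = (fun _ => (1 : ℚ)))
    (hQ_symm : (Qᵀ * A.map (Int.cast : ℤ → ℚ) * Q)ᵀ = Qᵀ * A.map (Int.cast : ℤ → ℚ) * Q)
    (hQ_diag : ∀ i, (Qᵀ * A.map (Int.cast : ℤ → ℚ) * Q) i i = 0)
    (hQ_01 : ∀ i j, (Qᵀ * A.map (Int.cast : ℤ → ℚ) * Q) i j = 0 ∨
      (Qᵀ * A.map (Int.cast : ℤ → ℚ) * Q) i j = 1)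
    (ℓ : ℕ) (hℓ_pos : 0 < ℓ)
    (hℓ_int : ∀ i j, ∃ z : ℤ, (ℓ : ℚ) * Q i j = (z : ℚ))
    (hℓ_min : ∀ m : ℕ, 0 < m → (∀ i j, ∃ z : ℤ, (m : ℚ) * Q i j = (z : ℚ)) → ℓ ≤ m) :
    ¬ (2 ∣ ℓ) := by
  have hB : ∃ B : Matrix (Fin n) (Fin n) ℤ,
      Qᵀ * A.map (Int.cast : ℤ → ℚ) * Q = B.map (Int.cast : ℤ → ℚ) := by
    have : ∀ i j, ∃ z : ℤ, (Qᵀ * A.map (Int.cast : ℤ → ℚ) * Q) i j = z := fun i j => by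
      rcases hQ_01 i j with h | h
      · exact ⟨0, by simpa using h⟩
      · exact ⟨1, by simpa using h⟩
    choose B hB using this
    exact ⟨B, ext hB⟩
  obtain ⟨B, hB⟩ := hB
  rw [hB] at hQ_symm hQ_diag
  have hB_symm : Bᵀ = B := by
    ext i j
    have h := congrFun (congrFun hQ_symm i) j
    simpa using h
  have hB_diag : ∀ i, B i i = 0 := fun i => by simpa using hQ_diag i
  have hAQ : A.map (Int.castRingHom ℚ) * Q = Q * B.map (Int.castRingHom ℚ) := by
    change A.map (Int.cast : ℤ → ℚ) * Q = Q * B.map (Int.cast : ℤ → ℚ)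
    rw [← hB, ← Matrix.mul_assoc, ← Matrix.mul_assoc, mul_eq_one_comm.1 hQ_orth, Matrix.one_mul]
  obtain ⟨ε, b, hε, hb, -, hdet⟩ := hF
  have hdet' : (walkMatrix A).det.natAbs = 2 ^ (n / 2) * b.natAbs := by
    have : walkMatrix A = W := hW.symm
    rw [this, hdet, Int.natAbs_mul, Int.natAbs_mul, Int.natAbs_pow]
    rcases hε with rfl | rfl <;> simp
  obtain ⟨d, ⟨c, rfl⟩, hd⟩ := exists_odd_mul_integral A B hA_symm hA_diag hB_symm hB_diag
    hb.natAbs hdet' Q hQ_orth hQ_e hAQ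
  rintro ⟨m, rfl⟩
  have := hℓ_min m (by omega) fun i j => by
    obtain ⟨z, hz⟩ := hd i j
    obtain ⟨w, hw⟩ := hℓ_int i j
    refine ⟨m * z - c * w, ?_⟩
    push_cast at hz hw ⊢
    rw [← hz, ← hw]
    ring
  omega
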